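/- Let t : ℤ → ℂ satisfy t_s = 0 for all s < −1, and let u_{k,l} = u_{l,k} ∈ ℂ for k, l ∈ ℕ. In the field ℂ((z)) of formal Laurent series define ξ*_k(z) := z^{2k+1}/(2k+1), η_k(z) := (2k+1) z^{−2k−2} + Σ_{l≥0} u_{k,l} z^{2l}, and θ(z) := Σ_{s≥−1} t_s z^{2s}, and define tensors indexed by ℕ: A^i_{j,k} := Res(ξ*_i · (ξ*_j)' · (ξ*_k)' · θ), B^i_{j,k} := Res(ξ*_i · (ξ*_j)' · η_k · θ), C^i_{j,k} := Res(ξ*_i · η_j · η_k · θ), where (·)' is the formal derivative d/dz and Res is the coefficient of z^{−1}. Then: (a) A^i_{j,k} = t_{−1} if i = j = k = 0 and A^i_{j,k} = 0 otherwise; in particular A is fully symmetric; (b) in the relations (BB-AC), (BC) and (BA) every sum over a ∈ ℕ has only finitely many nonzero terms, and all three relations hold; i.e. (A, B, C) defines a classical Airy structure. -/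

import Mathlib

/-- The formal derivative `d/dz` on formal Laurent series. -/
noncomputable def lDeriv (f : LaurentSeries ℂ) : LaurentSeries ℂ where
  coeff m := ((m + 1 : ℤ) : ℂ) * f.coeff (m + 1)
  isPWO_support' := by
    have hmono : Monotone (fun m : ℤ => m - 1) := fun a b hab => by simpa using hab
    refine Set.IsPWO.mono ((f.isPWO_support).image_of_monotone hmono) ?_
    intro m hm
    refine ⟨m + 1, ?_, by ring⟩
    intro h0
    apply hm
    simp [h0]

/-- `ξ*_k(z) = z^{2k+1}/(2k+1)`. -/
noncomputable def xiStar2 (k : ℕ) : LaurentSeries ℂ :=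
  HahnSeries.single (2 * (k : ℤ) + 1) (1 / (2 * (k : ℂ) + 1))

/-- `η_k(z) = (2k+1) z^{−2k−2} + Σ_{l≥0} u_{k,l} z^{2l}`. -/
noncomputable def eta15 (u : ℕ → ℕ → ℂ) (k : ℕ) : LaurentSeries ℂ :=
  HahnSeries.single (-2 * (k : ℤ) - 2) (2 * (k : ℂ) + 1)
    + HahnSeries.ofPowerSeries ℤ ℂ (PowerSeries.mk fun m => if m % 2 = 0 then u k (m / 2) else 0)

/-- `θ(z) = Σ_{s≥−1} t_s z^{2s}`. -/
noncomputable def theta15 (t : ℤ → ℂ) : LaurentSeries ℂ :=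
  HahnSeries.single (-2 : ℤ) (t (-1))
    + HahnSeries.ofPowerSeries ℤ ℂ (PowerSeries.mk fun m => if m % 2 = 0 then t (m / 2) else 0)

/-- `A^i_{jk} = Res(ξ*_i (ξ*_j)' (ξ*_k)' θ)`. -/
noncomputable def A15 (t : ℤ → ℂ) (i j k : ℕ) : ℂ :=
  (xiStar2 i * lDeriv (xiStar2 j) * lDeriv (xiStar2 k) * theta15 t).coeff (-1)

/-- `B^i_{jk} = Res(ξ*_i (ξ*_j)' η_k θ)`. -/
noncomputable def B15 (t : ℤ → ℂ) (u : ℕ → ℕ → ℂ) (i j k : ℕ) : ℂ :=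
  (xiStar2 i * lDeriv (xiStar2 j) * eta15 u k * theta15 t).coeff (-1)

/-- `C^i_{jk} = Res(ξ*_i η_j η_k θ)`. -/
noncomputable def C15 (t : ℤ → ℂ) (u : ℕ → ℕ → ℂ) (i j k : ℕ) : ℂ :=
  (xiStar2 i * eta15 u j * eta15 u k * theta15 t).coeff (-1)

theorem sum_Ico_neg_eq (f : ℤ → ℂ) (M : ℕ) :
    ∑ a ∈ Finset.Ico (-(M : ℤ)) M, f a
      = ∑ a ∈ Finset.range M, f a + ∑ a ∈ Finset.range M, f (-1 - a) := by
  induction M with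
  | zero => simp
  | succ M ih =>
    have h : Finset.Ico (-((M + 1 : ℕ) : ℤ)) ((M + 1 : ℕ) : ℤ)
        = insert (M : ℤ) (insert (-1 - (M : ℤ)) (Finset.Ico (-(M : ℤ)) M)) := by
      ext x
      simp only [Finset.mem_Ico, Finset.mem_insert]
      omega
    rw [h, Finset.sum_insert (by simp only [Finset.mem_insert, Finset.mem_Ico]; omega),
      Finset.sum_insert (by simp only [Finset.mem_Ico]; omega), ih,
      Finset.sum_range_succ, Finset.sum_range_succ]
    ring

/-- The antisymmetrisation of the pairing built from `η` and `ξ*'` does not see the symmetric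
matrix `u`, and equals the residue pairing. -/
theorem sum_pairing_sub_swap (u : ℕ → ℕ → ℂ) (hu : ∀ k l, u k l = u l k) (X Y : ℤ → ℂ) (M : ℕ) :
    ∑ a ∈ Finset.range M,
        ((2 * (a : ℂ) + 1) * X a + ∑ b ∈ Finset.range M, u a b * X (-1 - b)) * Y (-1 - a)
      - ∑ a ∈ Finset.range M,
        ((2 * (a : ℂ) + 1) * Y a + ∑ b ∈ Finset.range M, u a b * Y (-1 - b)) * X (-1 - a)
      = ∑ a ∈ Finset.Ico (-(M : ℤ)) M, (2 * (a : ℂ) + 1) * (X a * Y (-1 - a)) := by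
  have hswap : ∑ a ∈ Finset.range M, ∑ b ∈ Finset.range M, u a b * X (-1 - b) * Y (-1 - a)
      = ∑ a ∈ Finset.range M, ∑ b ∈ Finset.range M, u a b * Y (-1 - b) * X (-1 - a) := by
    rw [Finset.sum_comm]
    refine Finset.sum_congr rfl fun a _ => Finset.sum_congr rfl fun b _ => ?_
    rw [hu b a]
    ring
  have hexp (X Y : ℤ → ℂ) : ∑ a ∈ Finset.range M,
        ((2 * (a : ℂ) + 1) * X a + ∑ b ∈ Finset.range M, u a b * X (-1 - b)) * Y (-1 - a)
      = ∑ a ∈ Finset.range M, (2 * (a : ℂ) + 1) * (X a * Y (-1 - a))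
        + ∑ a ∈ Finset.range M, ∑ b ∈ Finset.range M, u a b * X (-1 - b) * Y (-1 - a) := by
    rw [← Finset.sum_add_distrib]
    refine Finset.sum_congr rfl fun a _ => ?_
    rw [add_mul, Finset.sum_mul, mul_assoc]
  rw [hexp, hexp, hswap, add_sub_add_right_eq_sub, sum_Ico_neg_eq, sub_eq_add_neg,
    ← Finset.sum_neg_distrib]
  congr 1
  refine Finset.sum_congr rfl fun a _ => ?_
  rw [sub_sub_cancel]
  push_cast
  ring

theorem support_coeff_mul_coeff_finite (F G : LaurentSeries ℂ) (n : ℤ) :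
    (Function.support fun p : ℤ => F.coeff p * G.coeff (n - p)).Finite := by
  refine (Set.Finite.subset (Finset.image Prod.fst
    (Finset.antidiagonal F.isPWO_support G.isPWO_support n)).finite_toSet) fun p hp => ?_
  simp only [Function.mem_support, mul_ne_zero_iff] at hp
  simp only [Finset.coe_image, Set.mem_image, Finset.mem_coe, Finset.mem_antidiagonal]
  exact ⟨(p, n - p), ⟨hp.1, hp.2, by simp⟩, rfl⟩

theorem coeff_mul_eq_finsum (F G : LaurentSeries ℂ) (n : ℤ) :
    (F * G).coeff n = ∑ᶠ p : ℤ, F.coeff p * G.coeff (n - p) := by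
  rw [HahnSeries.coeff_mul, finsum_eq_sum_of_support_subset (s := Finset.image Prod.fst
    (Finset.antidiagonal F.isPWO_support G.isPWO_support n))]
  · rw [Finset.sum_image]
    · refine Finset.sum_congr rfl fun x hx => ?_
      rw [Finset.mem_antidiagonal] at hx
      rw [← hx.2.2, add_sub_cancel_left]
    · rintro ⟨a, b⟩ hx ⟨c, d⟩ hy h
      simp only [Finset.mem_coe, Finset.mem_antidiagonal] at hx hy h
      exact Prod.ext h (by dsimp only at *; omega)
  · intro p hp
    simp only [Function.mem_support, mul_ne_zero_iff] at hp
    simp only [Finset.coe_image, Set.mem_image, Finset.mem_coe, Finset.mem_antidiagonal]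
    exact ⟨(p, n - p), ⟨hp.1, hp.2, by simp⟩, rfl⟩

/-- A weighted convolution, re-indexed by the shift `c`, as a sum over any large finite set. -/
theorem sum_shift_eq_finsum (w : ℤ → ℂ) (F G : LaurentSeries ℂ) (n c : ℤ) (s : Finset ℤ)
    (hs : ∀ a ∉ s, F.coeff (a - c) * G.coeff (n - a) = 0) :
    ∑ a ∈ s, w a * (F.coeff (a - c) * G.coeff (n - a))
      = ∑ᶠ p : ℤ, w (p + c) * (F.coeff p * G.coeff (n - c - p)) := by
  rw [← finsum_comp_equiv (Equiv.subRight c), finsum_eq_sum_of_support_subset (s := s)]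
  · refine Finset.sum_congr rfl fun a _ => ?_
    simp
  · intro a ha
    by_contra h
    apply ha
    have := hs a h
    simp only [Equiv.subRight_apply, sub_add_cancel, sub_sub_sub_cancel_right]
    rw [this, mul_zero]

theorem coeff_mul_eq_sum_shift (F G : LaurentSeries ℂ) (n c : ℤ) (s : Finset ℤ)
    (hs : ∀ a ∉ s, F.coeff (a - c) * G.coeff (n - a) = 0) :
    (F * G).coeff (n - c) = ∑ a ∈ s, F.coeff (a - c) * G.coeff (n - a) := by
  have h := sum_shift_eq_finsum (fun _ => 1) F G n c s hs
  simp only [one_mul] at h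
  rw [h, coeff_mul_eq_finsum]

/-- Integration by parts for the residue pairing, in coefficients. -/
theorem sum_shift_sub_sum_shift (G H : LaurentSeries ℂ) (i j : ℤ) (s : Finset ℤ)
    (hi : ∀ a ∉ s, G.coeff (a - i) * H.coeff (-1 - j - a) = 0)
    (hj : ∀ a ∉ s, G.coeff (a - j) * H.coeff (-1 - i - a) = 0) :
    ∑ a ∈ s, (2 * (a : ℂ) + 1) * (G.coeff (a - i) * H.coeff (-1 - j - a))
      - ∑ a ∈ s, (2 * (a : ℂ) + 1) * (G.coeff (a - j) * H.coeff (-1 - i - a))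
      = 2 * ((i : ℂ) - j) * (G * H).coeff (-1 - i - j) := by
  have hfin := support_coeff_mul_coeff_finite G H (-1 - i - j)
  rw [sum_shift_eq_finsum (fun a => 2 * (a : ℂ) + 1) _ _ _ _ _ hi,
    sum_shift_eq_finsum (fun a => 2 * (a : ℂ) + 1) _ _ _ _ _ hj, coeff_mul_eq_finsum,
    mul_finsum' _ _ hfin, show -1 - j - i = -1 - i - j by ring, ← finsum_sub_distrib]
  · refine finsum_congr fun p => ?_
    push_cast
    ring
  · exact hfin.subset (Function.support_mul_subset_right _ _)
  · exact hfin.subset (Function.support_mul_subset_right _ _)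

theorem coeff_single_one_mul (G : LaurentSeries ℂ) (c n : ℤ) :
    (HahnSeries.single c (1 : ℂ) * G).coeff n = G.coeff (n - c) := by
  have h := HahnSeries.coeff_single_mul_add (r := (1 : ℂ)) (x := G) (a := n - c) (b := c)
  rwa [sub_add_cancel, one_mul] at h

theorem exists_coeff_eq_zero_of_lt_neg (F : LaurentSeries ℂ) :
    ∃ N : ℕ, ∀ n : ℤ, n < -(N : ℤ) → F.coeff n = 0 :=
  ⟨F.order.natAbs, fun _ hn => HahnSeries.coeff_eq_zero_of_lt_order (by omega)⟩

theorem coeff_ofPowerSeries_mul_eq_sum (v : ℕ → ℂ) (G : LaurentSeries ℂ) (n : ℤ) (M : ℕ)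
    (hG : ∀ b : ℕ, M ≤ b → G.coeff (n - b) = 0) :
    (HahnSeries.ofPowerSeries ℤ ℂ (PowerSeries.mk v) * G).coeff n
      = ∑ b ∈ Finset.range M, v b * G.coeff (n - b) := by
  have h := coeff_mul_eq_sum_shift (HahnSeries.ofPowerSeries ℤ ℂ (PowerSeries.mk v)) G n 0
    ((Finset.range M).map Nat.castEmbedding) fun a ha => by
      rcases lt_or_ge a 0 with h0 | h0
      · rw [PowerSeries.coeff_coe, sub_zero, if_pos h0, zero_mul]
      · lift a to ℕ using h0
        rw [hG a (by simpa using ha), mul_zero]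
  rw [sub_zero] at h
  rw [h, Finset.sum_map]
  refine Finset.sum_congr rfl fun b _ => ?_
  simp [PowerSeries.coeff_coe]

/-- `η_k` in the variable `w = z²`. -/
noncomputable def etaHalf (u : ℕ → ℕ → ℂ) (k : ℕ) : LaurentSeries ℂ :=
  HahnSeries.single (-1 - (k : ℤ)) (2 * (k : ℂ) + 1)
    + HahnSeries.ofPowerSeries ℤ ℂ (PowerSeries.mk (u k))

/-- `Res_z (ξ*_i g h θ)` for `g`, `h`, `θ` series in the variable `w = z²`. -/
noncomputable def loopRes (θ : LaurentSeries ℂ) (i : ℕ) (g h : LaurentSeries ℂ) : ℂ :=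
  (g * h * θ).coeff (-1 - (i : ℤ)) / (2 * (i : ℂ) + 1)

theorem loopRes_etaHalf (θ : LaurentSeries ℂ) (u : ℕ → ℕ → ℂ) (i a M : ℕ) (g : LaurentSeries ℂ)
    (hM : ∀ n : ℤ, n < -(M : ℤ) → (g * θ).coeff n = 0) :
    loopRes θ i g (etaHalf u a) = ((2 * (a : ℂ) + 1) * (g * θ).coeff (a - i)
      + ∑ b ∈ Finset.range M, u a b * (g * θ).coeff (-1 - b - i)) / (2 * (i : ℂ) + 1) := by
  have hmul : g * etaHalf u a * θ
      = HahnSeries.single (-1 - (a : ℤ)) (2 * (a : ℂ) + 1) * (g * θ)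
        + HahnSeries.ofPowerSeries ℤ ℂ (PowerSeries.mk (u a)) * (g * θ) := by
    rw [etaHalf]
    ring
  have hsingle := HahnSeries.coeff_single_mul_add (r := 2 * (a : ℂ) + 1) (x := g * θ)
    (a := (a : ℤ) - i) (b := -1 - (a : ℤ))
  rw [show (a : ℤ) - i + (-1 - a) = -1 - i by ring] at hsingle
  rw [loopRes, hmul, HahnSeries.coeff_add, hsingle,
    coeff_ofPowerSeries_mul_eq_sum _ _ _ M fun b hb => hM _ (by omega)]
  simp only [sub_right_comm]

theorem loopRes_single (θ : LaurentSeries ℂ) (j a : ℕ) (h : LaurentSeries ℂ) :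
    loopRes θ j (HahnSeries.single (a : ℤ) 1) h
      = (h * θ).coeff (-1 - a - j) / (2 * (j : ℂ) + 1) := by
  rw [loopRes, mul_assoc, coeff_single_one_mul, sub_right_comm]

/-- The summand common to the three quadratic relations. -/
noncomputable def relTerm (θ : LaurentSeries ℂ) (u : ℕ → ℕ → ℂ) (g h : LaurentSeries ℂ)
    (i j a : ℕ) : ℂ :=
  loopRes θ i (HahnSeries.single (j : ℤ) 1) (etaHalf u a) * loopRes θ a g h
    + loopRes θ i g (etaHalf u a) * loopRes θ j (HahnSeries.single (a : ℤ) 1) h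
    + loopRes θ i h (etaHalf u a) * loopRes θ j (HahnSeries.single (a : ℤ) 1) g

theorem exists_relTerm_eq_zero (θ : LaurentSeries ℂ) (u : ℕ → ℕ → ℂ) (g h : LaurentSeries ℂ) :
    ∃ N : ℕ, ∀ i j a : ℕ, N ≤ a → relTerm θ u g h i j a = 0 := by
  obtain ⟨N₁, h₁⟩ := exists_coeff_eq_zero_of_lt_neg (g * θ)
  obtain ⟨N₂, h₂⟩ := exists_coeff_eq_zero_of_lt_neg (h * θ)
  obtain ⟨N₃, h₃⟩ := exists_coeff_eq_zero_of_lt_neg (g * h * θ)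
  refine ⟨N₁ + N₂ + N₃, fun i j a ha => ?_⟩
  have h₃' : loopRes θ a g h = 0 := by rw [loopRes, h₃ _ (by omega), zero_div]
  rw [relTerm, loopRes_single θ j a g, loopRes_single θ j a h, h₃', h₁ _ (by omega),
    h₂ _ (by omega)]
  simp

theorem relTerm_support_finite (θ : LaurentSeries ℂ) (u : ℕ → ℕ → ℂ) (g h : LaurentSeries ℂ)
    (i j : ℕ) : (Function.support (relTerm θ u g h i j)).Finite := by
  obtain ⟨N, hN⟩ := exists_relTerm_eq_zero θ u g h
  refine (Finset.range N).finite_toSet.subset fun a ha => ?_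
  by_contra hlt
  exact ha (hN i j a (by simpa using hlt))

theorem two_mul_add_one_ne_zero (n : ℕ) : 2 * (n : ℂ) + 1 ≠ 0 := by
  exact_mod_cast (2 * n).succ_ne_zero

theorem sum_loopRes_sub_swap (θ : LaurentSeries ℂ) (hθ : ∀ n : ℤ, n < -1 → θ.coeff n = 0)
    (u : ℕ → ℕ → ℂ) (g h : LaurentSeries ℂ) (i j M : ℕ) (hM1 : 1 ≤ M)
    (hM : ∀ n : ℤ, n < -(M : ℤ) → (g * h * θ).coeff n = 0) :
    ∑ a ∈ Finset.range M,
        loopRes θ i (HahnSeries.single (j : ℤ) 1) (etaHalf u a) * loopRes θ a g h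
      - ∑ a ∈ Finset.range M,
        loopRes θ j (HahnSeries.single (i : ℤ) 1) (etaHalf u a) * loopRes θ a g h
      = 2 * ((j : ℂ) - i) * (g * θ * (h * θ)).coeff (-1 - i - j)
        / ((2 * (i : ℂ) + 1) * (2 * (j : ℂ) + 1)) := by
  rcases eq_or_ne i j with rfl | hij
  · simp
  have hi := two_mul_add_one_ne_zero i
  have hj := two_mul_add_one_ne_zero j
  have hconv := coeff_mul_eq_sum_shift θ (g * h * θ) (-1) (i + j)
    ((Finset.range M).map Nat.castEmbedding) fun a ha => by
      rcases lt_or_ge a 0 with h0 | h0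
      · rw [hθ _ (by omega), zero_mul]
      · lift a to ℕ using h0
        have : M ≤ a := by simpa using ha
        rw [hM _ (by omega), mul_zero]
  rw [Finset.sum_map, show θ * (g * h * θ) = g * θ * (h * θ) by ring, ← sub_sub] at hconv
  have hterm (i' j' : ℕ) (hs : i' + j' = i + j) (a : ℕ) :
      loopRes θ i' (HahnSeries.single (j' : ℤ) 1) (etaHalf u a) * loopRes θ a g h
        = (θ.coeff (a - (i + j)) * (g * h * θ).coeff (-1 - a)) / (2 * (i' : ℂ) + 1) := by
    have ha := two_mul_add_one_ne_zero a
    have hi' := two_mul_add_one_ne_zero i'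
    rw [loopRes_etaHalf θ u i' a M _ fun n hn => by
      rw [coeff_single_one_mul]; exact hθ _ (by omega)]
    rw [Finset.sum_eq_zero fun b _ => by
      rw [coeff_single_one_mul, hθ _ (by omega), mul_zero], coeff_single_one_mul, loopRes,
      show (a : ℤ) - i' - j' = a - (i + j) by omega]
    field_simp
    ring
  simp only [hterm i j rfl, hterm j i (add_comm _ _), ← Finset.sum_div]
  simp only [Nat.castEmbedding_apply] at hconv
  rw [← hconv]
  field_simp
  ring

theorem finsum_relTerm_swap (θ : LaurentSeries ℂ) (hθ : ∀ n : ℤ, n < -1 → θ.coeff n = 0)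
    (u : ℕ → ℕ → ℂ) (hu : ∀ k l, u k l = u l k) (g h : LaurentSeries ℂ) (i j : ℕ) :
    ∑ᶠ a, relTerm θ u g h i j a = ∑ᶠ a, relTerm θ u g h j i a := by
  obtain ⟨N₀, h₀⟩ := exists_relTerm_eq_zero θ u g h
  obtain ⟨N₁, h₁⟩ := exists_coeff_eq_zero_of_lt_neg (g * θ)
  obtain ⟨N₂, h₂⟩ := exists_coeff_eq_zero_of_lt_neg (h * θ)
  obtain ⟨N₃, h₃⟩ := exists_coeff_eq_zero_of_lt_neg (g * h * θ)
  obtain ⟨M, hM⟩ : ∃ M : ℕ, M = N₀ + N₁ + N₂ + N₃ + i + j + 1 := ⟨_, rfl⟩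
  have hsum (i j : ℕ) : ∑ᶠ a, relTerm θ u g h i j a
      = ∑ a ∈ Finset.range M, relTerm θ u g h i j a := by
    refine finsum_eq_sum_of_support_subset _ fun a ha => ?_
    by_contra hlt
    have : M ≤ a := by simpa using hlt
    exact ha (h₀ i j a (by omega))
  have hG (n : ℤ) (hn : n < -(M : ℤ)) : (g * θ).coeff n = 0 := h₁ n (by omega)
  have hH (n : ℤ) (hn : n < -(M : ℤ)) : (h * θ).coeff n = 0 := h₂ n (by omega)
  have hfirst := sum_loopRes_sub_swap θ hθ u g h i j M (by omega) fun n hn => h₃ n (by omega)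
  have hpair₁ := sum_pairing_sub_swap u hu (fun n => (g * θ).coeff (n - i))
    (fun n => (h * θ).coeff (n - j)) M
  have hpair₂ := sum_pairing_sub_swap u hu (fun n => (g * θ).coeff (n - j))
    (fun n => (h * θ).coeff (n - i)) M
  have hout (i j : ℕ) (hij : N₁ + N₂ + i + j + 1 ≤ M) (a : ℤ)
      (ha : a ∉ Finset.Ico (-(M : ℤ)) M) :
      (g * θ).coeff (a - i) * (h * θ).coeff (-1 - j - a) = 0 := by
    rw [Finset.mem_Ico, not_and_or, not_le, not_lt] at ha
    rcases ha with ha | ha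
    · rw [h₁ _ (by omega), zero_mul]
    · rw [h₂ _ (by omega), mul_zero]
  have hparts := sum_shift_sub_sum_shift (g * θ) (h * θ) i j (Finset.Ico (-(M : ℤ)) M)
    (hout i j (by omega)) (hout j i (by omega))
  simp only [sub_right_comm (-1 : ℤ) _ (i : ℤ), sub_right_comm (-1 : ℤ) _ (j : ℤ)]
    at hpair₁ hpair₂
  have hprod (p q : LaurentSeries ℂ) (hp : ∀ n : ℤ, n < -(M : ℤ) → (p * θ).coeff n = 0)
      (i j : ℕ) : ∑ a ∈ Finset.range M,
        loopRes θ i p (etaHalf u a) * loopRes θ j (HahnSeries.single (a : ℤ) 1) q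
      = (∑ a ∈ Finset.range M, ((2 * (a : ℂ) + 1) * (p * θ).coeff (a - i)
        + ∑ b ∈ Finset.range M, u a b * (p * θ).coeff (-1 - i - b)) * (q * θ).coeff (-1 - j - a))
        / ((2 * (i : ℂ) + 1) * (2 * (j : ℂ) + 1)) := by
    rw [Finset.sum_div]
    refine Finset.sum_congr rfl fun a _ => ?_
    rw [loopRes_etaHalf θ u i a M p hp, loopRes_single, div_mul_div_comm]
    simp only [sub_right_comm (-1 : ℤ) _ (i : ℤ), sub_right_comm (-1 : ℤ) _ (j : ℤ)]
  rw [hsum, hsum]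
  simp only [relTerm, Finset.sum_add_distrib, hprod g h hG, hprod h g hH]
  linear_combination hfirst + (hpair₁ - hpair₂ + hparts) / ((2 * (i : ℂ) + 1) * (2 * (j : ℂ) + 1))

/-- The substitution `w ↦ z²` on Laurent series. -/
noncomputable def sqSubst : LaurentSeries ℂ →+* LaurentSeries ℂ :=
  HahnSeries.embDomainRingHom (AddMonoidHom.mulLeft (2 : ℤ))
    (fun a b h => by simpa using h) (fun a b => by simp)

theorem sqSubst_coeff_two_mul (F : LaurentSeries ℂ) (n : ℤ) :
    (sqSubst F).coeff (2 * n) = F.coeff n :=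
  HahnSeries.embDomain_coeff

theorem sqSubst_coeff_of_not_even (F : LaurentSeries ℂ) {n : ℤ} (hn : ¬ Even n) :
    (sqSubst F).coeff n = 0 := by
  refine HahnSeries.embDomain_of_notMem_range ?_
  rintro ⟨m, rfl⟩
  exact hn ⟨m, two_mul m⟩

theorem sqSubst_single (n : ℤ) (c : ℂ) :
    sqSubst (HahnSeries.single n c) = HahnSeries.single (2 * n) c :=
  HahnSeries.embDomain_single

theorem sqSubst_ofPowerSeries (v : ℕ → ℂ) :
    sqSubst (HahnSeries.ofPowerSeries ℤ ℂ (PowerSeries.mk v))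
      = HahnSeries.ofPowerSeries ℤ ℂ
        (PowerSeries.mk fun m => if m % 2 = 0 then v (m / 2) else 0) := by
  ext n
  rw [PowerSeries.coeff_coe]
  rcases Int.even_or_odd n with h | h
  · obtain ⟨m, rfl⟩ := h
    rw [← two_mul, sqSubst_coeff_two_mul, PowerSeries.coeff_coe]
    have h2 : (2 * m).natAbs = 2 * m.natAbs := by omega
    have h3 : 2 * m < 0 ↔ m < 0 := by omega
    simp [h2, h3]
  · rw [sqSubst_coeff_of_not_even _ (Int.not_even_iff_odd.mpr h), PowerSeries.coeff_mk,
      if_neg (c := n.natAbs % 2 = 0), ite_self]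
    obtain ⟨m, rfl⟩ := h
    omega

/-- `θ` in the variable `w = z²`. -/
noncomputable def thetaHalf (t : ℤ → ℂ) : LaurentSeries ℂ :=
  HahnSeries.single (-1 : ℤ) (t (-1)) + HahnSeries.ofPowerSeries ℤ ℂ (PowerSeries.mk fun m => t m)

theorem thetaHalf_coeff (t : ℤ → ℂ) (ht : ∀ s : ℤ, s < -1 → t s = 0) (n : ℤ) :
    (thetaHalf t).coeff n = t n := by
  rw [thetaHalf, HahnSeries.coeff_add, PowerSeries.coeff_coe, PowerSeries.coeff_mk]
  rcases lt_trichotomy n (-1) with h | rfl | h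
  · rw [HahnSeries.coeff_single_of_ne h.ne, if_pos (by omega), ht n h, add_zero]
  · simp
  · rw [HahnSeries.coeff_single_of_ne h.ne', if_neg (by omega), zero_add,
      Int.natAbs_of_nonneg (by omega)]

theorem theta15_eq_sqSubst (t : ℤ → ℂ) : theta15 t = sqSubst (thetaHalf t) := by
  rw [thetaHalf, map_add, sqSubst_single, sqSubst_ofPowerSeries, theta15]
  congr 4

theorem eta15_eq_sqSubst (u : ℕ → ℕ → ℂ) (k : ℕ) : eta15 u k = sqSubst (etaHalf u k) := by
  rw [etaHalf, map_add, sqSubst_single, sqSubst_ofPowerSeries, eta15,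
    show 2 * (-1 - (k : ℤ)) = -2 * k - 2 by ring]

theorem lDeriv_xiStar2 (k : ℕ) :
    lDeriv (xiStar2 k) = sqSubst (HahnSeries.single (k : ℤ) 1) := by
  rw [sqSubst_single]
  ext n
  change ((n + 1 : ℤ) : ℂ) * (xiStar2 k).coeff (n + 1) = _
  rw [xiStar2]
  rcases eq_or_ne n (2 * (k : ℤ)) with rfl | h
  · have := two_mul_add_one_ne_zero k
    rw [HahnSeries.coeff_single_same, HahnSeries.coeff_single_same]
    push_cast
    field_simp
  · rw [HahnSeries.coeff_single_of_ne h, HahnSeries.coeff_single_of_ne (by omega), mul_zero]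

theorem coeff_xiStar2_mul_sqSubst (i : ℕ) (g h θ : LaurentSeries ℂ) :
    (xiStar2 i * sqSubst g * sqSubst h * sqSubst θ).coeff (-1) = loopRes θ i g h := by
  have hc := HahnSeries.coeff_single_mul_add (r := 1 / (2 * (i : ℂ) + 1))
    (x := sqSubst (g * h * θ)) (a := 2 * (-1 - (i : ℤ))) (b := 2 * (i : ℤ) + 1)
  rw [show 2 * (-1 - (i : ℤ)) + (2 * i + 1) = -1 by ring, sqSubst_coeff_two_mul, map_mul,
    map_mul] at hc
  rw [loopRes, mul_assoc, mul_assoc, ← mul_assoc (sqSubst g), xiStar2, hc]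
  ring

theorem A15_eq_loopRes (t : ℤ → ℂ) (i j k : ℕ) : A15 t i j k
    = loopRes (thetaHalf t) i (HahnSeries.single (j : ℤ) 1) (HahnSeries.single (k : ℤ) 1) := by
  rw [A15, lDeriv_xiStar2, lDeriv_xiStar2, theta15_eq_sqSubst, coeff_xiStar2_mul_sqSubst]

theorem B15_eq_loopRes (t : ℤ → ℂ) (u : ℕ → ℕ → ℂ) (i j k : ℕ) : B15 t u i j k
    = loopRes (thetaHalf t) i (HahnSeries.single (j : ℤ) 1) (etaHalf u k) := by
  rw [B15, lDeriv_xiStar2, eta15_eq_sqSubst, theta15_eq_sqSubst, coeff_xiStar2_mul_sqSubst]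

theorem C15_eq_loopRes (t : ℤ → ℂ) (u : ℕ → ℕ → ℂ) (i j k : ℕ) : C15 t u i j k
    = loopRes (thetaHalf t) i (etaHalf u j) (etaHalf u k) := by
  rw [C15, eta15_eq_sqSubst, eta15_eq_sqSubst, theta15_eq_sqSubst, coeff_xiStar2_mul_sqSubst]

theorem A15_eq_ite (t : ℤ → ℂ) (ht : ∀ s : ℤ, s < -1 → t s = 0) (i j k : ℕ) :
    A15 t i j k = if i = 0 ∧ j = 0 ∧ k = 0 then t (-1) else 0 := by
  rw [A15_eq_loopRes, loopRes_single, coeff_single_one_mul, thetaHalf_coeff t ht]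
  split_ifs with h
  · obtain ⟨rfl, rfl, rfl⟩ := h
    simp
  · rw [ht _ (by omega), zero_div]

/-- The `ℤ₂`-invariant loop-space Airy structure on `V = ℂ[[z²]]`:
(a) `A^i_{jk} = t_{−1}` if `i = j = k = 0` and `0` otherwise; in particular `A` is fully
symmetric;
(b) each sum over `a ∈ ℕ` in the (BB-AC), (BC), (BA) relations has finite support, and
the three relations hold, i.e. `(A,B,C)` defines a classical Airy structure. -/
theorem stmt15 (t : ℤ → ℂ) (ht : ∀ s : ℤ, s < -1 → t s = 0)
    (u : ℕ → ℕ → ℂ) (hu : ∀ k l, u k l = u l k) :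
    (∀ i j k : ℕ, A15 t i j k = if i = 0 ∧ j = 0 ∧ k = 0 then t (-1) else 0)
    ∧ (∀ i j k : ℕ, A15 t i j k = A15 t j i k)
    ∧ (∀ i j k : ℕ, A15 t i j k = A15 t i k j)
    ∧ (∀ i j k l : ℕ,
        (Function.support fun a : ℕ => B15 t u i j a * B15 t u a k l
          + B15 t u i k a * B15 t u j a l + C15 t u i l a * A15 t j a k).Finite)
    ∧ (∀ i j k l : ℕ,
        ∑ᶠ a : ℕ, (B15 t u i j a * B15 t u a k l + B15 t u i k a * B15 t u j a l
            + C15 t u i l a * A15 t j a k)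
          = ∑ᶠ a : ℕ, (B15 t u j i a * B15 t u a k l + B15 t u j k a * B15 t u i a l
            + C15 t u j l a * A15 t i a k))
    ∧ (∀ i j k l : ℕ,
        (Function.support fun a : ℕ => B15 t u i j a * C15 t u a k l
          + C15 t u i k a * B15 t u j a l + C15 t u i l a * B15 t u j a k).Finite)
    ∧ (∀ i j k l : ℕ,
        ∑ᶠ a : ℕ, (B15 t u i j a * C15 t u a k l + C15 t u i k a * B15 t u j a l
            + C15 t u i l a * B15 t u j a k)
          = ∑ᶠ a : ℕ, (B15 t u j i a * C15 t u a k l + C15 t u j k a * B15 t u i a l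
            + C15 t u j l a * B15 t u i a k))
    ∧ (∀ i j k l : ℕ,
        (Function.support fun a : ℕ => B15 t u i j a * A15 t a k l
          + B15 t u i k a * A15 t j a l + B15 t u i l a * A15 t j a k).Finite)
    ∧ (∀ i j k l : ℕ,
        ∑ᶠ a : ℕ, (B15 t u i j a * A15 t a k l + B15 t u i k a * A15 t j a l
            + B15 t u i l a * A15 t j a k)
          = ∑ᶠ a : ℕ, (B15 t u j i a * A15 t a k l + B15 t u j k a * A15 t i a l
            + B15 t u j l a * A15 t i a k)) := by
  have hθ (n : ℤ) (hn : n < -1) : (thetaHalf t).coeff n = 0 := by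
    rw [thetaHalf_coeff t ht, ht n hn]
  have hfin := relTerm_support_finite (thetaHalf t) u
  have hswap := finsum_relTerm_swap (thetaHalf t) hθ u hu
  refine ⟨A15_eq_ite t ht, fun i j k => ?_, fun i j k => ?_, ?_, ?_, ?_, ?_, ?_, ?_⟩
  · simp only [A15_eq_ite t ht, and_left_comm]
  · simp only [A15_eq_ite t ht, and_comm (a := j = 0)]
  all_goals
    intro i j k l
    simp only [A15_eq_loopRes, B15_eq_loopRes, C15_eq_loopRes]
  · exact hfin (HahnSeries.single (k : ℤ) 1) (etaHalf u l) i j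
  · exact hswap (HahnSeries.single (k : ℤ) 1) (etaHalf u l) i j
  · exact hfin (etaHalf u k) (etaHalf u l) i j
  · exact hswap (etaHalf u k) (etaHalf u l) i j
  · exact hfin (HahnSeries.single (k : ℤ) 1) (HahnSeries.single (l : ℤ) 1) i j
  · exact hswap (HahnSeries.single (k : ℤ) 1) (HahnSeries.single (l : ℤ) 1) i j
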